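/- arXiv:2102.02195 — 2 statements merged into one kernel-verified Lean document; each statement's English description precedes it below -/
import Mathlib

section
/- Let n ≥ 1, let f ∈ End(ℂⁿ), let K ⊆ ℂⁿ be compact, and let p ∈ ℂⁿ \ rne(f). Let W be a neighbourhood of f in End(ℂⁿ) and V a neighbourhood of p in ℂⁿ. Then: (a) there exist h ∈ W and q ∈ V such that q is a super-attracting periodic point of h and h^[j](q) ∉ K for some j ≥ 0; (b) there exist h ∈ W and q ∈ V such that q is a repelling periodic point of h and h^[j](q) ∉ K for some j ≥ 0; (c) if n ≥ 2, there exist h ∈ W and q ∈ V such that q is a saddle periodic point of h and h^[j](q) ∉ K for some j ≥ 0. (Theorem 2.5 of the paper, a closing lemma, proved for Oka-Stein manifolds; specialized to ℂⁿ.) -/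
open Function Topology Filter Metric

noncomputable section

/-- `ℂⁿ` as a Euclidean space. -/
abbrev Cn (n : ℕ) := EuclideanSpace ℂ (Fin n)

/-- The space `End(ℂⁿ)` of holomorphic self-maps of `ℂⁿ`, topologized as a subspace of
the continuous maps `C(ℂⁿ, ℂⁿ)` with the compact-open topology. -/
abbrev Endo (n : ℕ) := {f : C(Cn n, Cn n) // Differentiable ℂ ⇑f}

variable {n : ℕ}

/-- The underlying function of an endomorphism. -/
def eapp (f : Endo n) : Cn n → Cn n := ⇑f.1

/-- `p` is a periodic point of `f`. -/
def IsPer (f : Endo n) (p : Cn n) : Prop := ∃ m, 1 ≤ m ∧ (eapp f)^[m] p = p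

/-- The minimal period of a periodic point. -/
def minPer (f : Endo n) (p : Cn n) : ℕ := Function.minimalPeriod (eapp f) p

/-- The eigenvalues at a periodic point `p`: the spectrum of the derivative of the
`minPer f p`-th iterate at `p`. -/
def eigs (f : Endo n) (p : Cn n) : Set ℂ := spectrum ℂ (fderiv ℂ ((eapp f)^[minPer f p]) p)

/-- Hyperbolic periodic point: no eigenvalue of absolute value 1. -/
def IsHypPer (f : Endo n) (p : Cn n) : Prop := IsPer f p ∧ ∀ z ∈ eigs f p, ‖z‖ ≠ 1

/-- Attracting periodic point: all eigenvalues of absolute value < 1. -/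
def IsAttPer (f : Endo n) (p : Cn n) : Prop := IsPer f p ∧ ∀ z ∈ eigs f p, ‖z‖ < 1

/-- Repelling periodic point: all eigenvalues of absolute value > 1. -/
def IsRepPer (f : Endo n) (p : Cn n) : Prop := IsPer f p ∧ ∀ z ∈ eigs f p, 1 < ‖z‖

/-- Saddle periodic point: hyperbolic with eigenvalues of absolute value both < 1 and > 1. -/
def IsSadPer (f : Endo n) (p : Cn n) : Prop :=
  IsHypPer f p ∧ (∃ z ∈ eigs f p, ‖z‖ < 1) ∧ (∃ z ∈ eigs f p, 1 < ‖z‖)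

/-- Super-attracting periodic point: the derivative of the `minPer`-th iterate vanishes. -/
def IsSuperAttPer (f : Endo n) (p : Cn n) : Prop :=
  IsPer f p ∧ fderiv ℂ ((eapp f)^[minPer f p]) p = 0

/-- The set of attracting periodic points of `f`. -/
def attSet (f : Endo n) : Set (Cn n) := {p | IsAttPer f p}

/-- The set of repelling periodic points of `f`. -/
def repSet (f : Endo n) : Set (Cn n) := {p | IsRepPer f p}

/-- The set of saddle periodic points of `f`. -/
def sadSet (f : Endo n) : Set (Cn n) := {p | IsSadPer f p}

/-- The robustly non-expelling set of `f`. -/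
def rne (f : Endo n) : Set (Cn n) :=
  {p | ∃ U : Set (Cn n), IsOpen U ∧ p ∈ U ∧ ∃ V ∈ 𝓝 f, ∃ K : Set (Cn n),
        IsCompact K ∧ ∀ g ∈ V, ∀ j : ℕ, (eapp g)^[j] '' U ⊆ K}

/-- A sequence of maps diverges locally uniformly to infinity on `U`. -/
def DivLocUnifOn (F : ℕ → Cn n → Cn n) (U : Set (Cn n)) : Prop :=
  ∀ L ⊆ U, IsCompact L → ∀ K : Set (Cn n), IsCompact K →
    ∀ᶠ j in atTop, Disjoint (F j '' L) K

/-- `p` belongs to the Fatou set of `f`: the iterates form a normal family near `p`. -/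
def FatouAt (f : Endo n) (p : Cn n) : Prop :=
  ∃ U : Set (Cn n), IsOpen U ∧ p ∈ U ∧
    ∀ k : ℕ → ℕ, StrictMono k → ∃ l : ℕ → ℕ, StrictMono l ∧
      ((∃ g : Cn n → Cn n, DifferentiableOn ℂ g U ∧
          TendstoLocallyUniformlyOn (fun j => (eapp f)^[k (l j)]) g atTop U) ∨
        DivLocUnifOn (fun j => (eapp f)^[k (l j)]) U)

/-- The Fatou set of `f`. -/
def Fatou (f : Endo n) : Set (Cn n) := {p | FatouAt f p}

/-- The Julia set of `f`. -/
def Julia (f : Endo n) : Set (Cn n) := (Fatou f)ᶜ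

/-- The cycle (finite orbit) of a periodic point `p`. -/
def cycleOf (f : Endo n) (p : Cn n) : Set (Cn n) := {x | ∃ i < minPer f p, (eapp f)^[i] p = x}

/-- The basin of attraction of the cycle of `p`. -/
def basinOf (f : Endo n) (p : Cn n) : Set (Cn n) :=
  {x | ∃ a ∈ cycleOf f p, Tendsto (fun k => (eapp f)^[minPer f p * k] x) atTop (𝓝 a)}

/-- The non-wandering set of `f`. -/
def nonWandering (f : Endo n) : Set (Cn n) :=
  {p | ∀ U ∈ 𝓝 p, ∃ k, 1 ≤ k ∧ (U ∩ (eapp f)^[k] '' U).Nonempty}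

/-- The set of points whose orbit can be closed in the weak sense. -/
def cloSet (f : Endo n) : Set (Cn n) :=
  {p | ∀ U ∈ 𝓝 p, ∀ V ∈ 𝓝 f, ∃ g ∈ V, ∃ q ∈ U, IsPer g q}

/-- `𝒯(m,K)`: endomorphisms all of whose periodic points in `K` of minimal period at most `m`
are transverse. -/
def TransSet (n : ℕ) (m : ℕ) (K : Set (Cn n)) : Set (Endo n) :=
  {f | ∀ p ∈ K, IsPer f p → minPer f p ≤ m → (1 : ℂ) ∉ eigs f p}

/-- `ℋ(m,K)`: endomorphisms all of whose periodic points in `K` of minimal period at most `m`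
are hyperbolic. -/
def HypSet (n : ℕ) (m : ℕ) (K : Set (Cn n)) : Set (Endo n) :=
  {f | ∀ p ∈ K, IsPer f p → minPer f p ≤ m → ∀ z ∈ eigs f p, ‖z‖ ≠ 1}

/-- The `m`-th iterate of an endomorphism as an endomorphism. -/
def iterEndo (f : Endo n) (m : ℕ) : Endo n :=
  ⟨⟨(eapp f)^[m], f.1.continuous.iterate m⟩, f.2.iterate m⟩

/-- The set of points with relatively compact forward orbit. -/
def boundedOrb (f : Endo n) : Set (Cn n) :=
  {p | ∃ K : Set (Cn n), IsCompact K ∧ ∀ k : ℕ, (eapp f)^[k] p ∈ K}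

/-- An `ε`-chain (pseudo-orbit) of `f` from `x` to `y`. -/
def EpsChain (f : Endo n) (ε : Cn n → ℝ) (x y : Cn n) : Prop :=
  ∃ N : ℕ, 1 ≤ N ∧ ∃ c : ℕ → Cn n, c 0 = x ∧ c N = y ∧
    ∀ j < N, dist (eapp f (c j)) (c (j + 1)) < ε (eapp f (c j))

/-- `x` and `y` are chain-equivalent for `f`. -/
def ChainEquiv (f : Endo n) (x y : Cn n) : Prop :=
  ∀ ε : Cn n → ℝ, Continuous ε → (∀ z, 0 < ε z) → EpsChain f ε x y ∧ EpsChain f ε y x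

/-- `x` is chain-recurrent for `f`. -/
def ChainRec (f : Endo n) (x : Cn n) : Prop :=
  ∀ ε : Cn n → ℝ, Continuous ε → (∀ z, 0 < ε z) → EpsChain f ε x x

/-- Attracting fixed point. -/
def IsAttFix (f : Endo n) (p : Cn n) : Prop :=
  eapp f p = p ∧ ∀ z ∈ spectrum ℂ (fderiv ℂ (eapp f) p), ‖z‖ < 1

/-- Repelling fixed point. -/
def IsRepFix (f : Endo n) (p : Cn n) : Prop :=
  eapp f p = p ∧ ∀ z ∈ spectrum ℂ (fderiv ℂ (eapp f) p), 1 < ‖z‖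

/-- Saddle fixed point. -/
def IsSadFix (f : Endo n) (p : Cn n) : Prop :=
  eapp f p = p ∧ (∀ z ∈ spectrum ℂ (fderiv ℂ (eapp f) p), ‖z‖ ≠ 1) ∧
    (∃ z ∈ spectrum ℂ (fderiv ℂ (eapp f) p), ‖z‖ < 1) ∧
    (∃ z ∈ spectrum ℂ (fderiv ℂ (eapp f) p), 1 < ‖z‖)

/-- `f` is a local biholomorphism at `p`: `f` agrees near `p` with a homeomorphism onto an
open set whose inverse is holomorphic. -/
def LocalBiholoAt (f : Endo n) (p : Cn n) : Prop :=
  ∃ φ : PartialHomeomorph (Cn n) (Cn n), p ∈ φ.source ∧ Set.EqOn (eapp f) φ φ.source ∧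
    DifferentiableOn ℂ φ.symm φ.target

lemma cl_theta {E : Type*} [NormedAddCommGroup E] [NormedSpace ℂ E]
    {c : E → ℂ} (hc : Differentiable ℂ c) (x : E) (h : c x = 0 ∨ c x = 1) :
    HasFDerivAt (fun z => c z ^ 2 * (3 - 2 * c z)) (0 : E →L[ℂ] ℂ) x := by
  have h1 : HasDerivAt (fun w : ℂ => w ^ 2 * (3 - 2 * w)) 0 (c x) := by
    have h2 := ((hasDerivAt_id (c x)).pow 2).mul (((hasDerivAt_id (c x)).const_mul 2).const_sub 3)
    refine (h2.congr_deriv ?_)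
    rcases h with h | h <;> simp [h] <;> norm_num
  have := h1.comp_hasFDerivAt x (hc x).hasFDerivAt
  refine this.congr_fderiv ?_
  ext z
  simp

lemma cl_interp {E : Type*} [NormedAddCommGroup E] [InnerProductSpace ℂ E]
    (S : Finset E) (v : E → E) (B : E → (E →L[ℂ] E)) :
    ∃ F : E → E, Differentiable ℂ F ∧ ∀ s ∈ S, F s = v s ∧ HasFDerivAt F (B s) s := by
  classical
  let m : E → E → E → ℂ := fun s t z => innerSL ℂ (s - t) (z - t) / innerSL ℂ (s - t) (s - t)
  have hm : ∀ s t, Differentiable ℂ (m s t) := by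
    intro s t
    have : Differentiable ℂ (fun z => innerSL ℂ (s - t) (z - t)) := by fun_prop
    simp only [m, div_eq_mul_inv]
    exact this.mul_const _
  let c : E → E → ℂ := fun s z => ∏ t ∈ S.erase s, m s t z
  have hc : ∀ s, Differentiable ℂ (c s) := by
    intro s
    intro x
    exact (HasFDerivAt.finsetProd (fun t _ => (hm s t x).hasFDerivAt)).differentiableAt
  have hc1 : ∀ s, c s s = 1 := by
    intro s
    refine Finset.prod_eq_one fun t ht => ?_
    have : s - t ≠ 0 := sub_ne_zero.2 (Finset.ne_of_mem_erase ht).symm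
    exact div_self (inner_self_ne_zero.2 this)
  have hc0 : ∀ s, ∀ t ∈ S, t ≠ s → c s t = 0 := by
    intro s t ht hts
    refine Finset.prod_eq_zero (Finset.mem_erase.2 ⟨hts, ht⟩) ?_
    simp [m]
  refine ⟨fun z => ∑ s ∈ S, (c s z ^ 2 * (3 - 2 * c s z)) • (v s + B s (z - s)), ?_, ?_⟩
  · refine Differentiable.fun_sum fun s _ => ?_
    have := hc s
    fun_prop
  · intro t ht
    constructor
    · beta_reduce
      rw [Finset.sum_eq_single t]
      · rw [hc1]; norm_num
      · intro s _ hst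
        rw [hc0 s t ht hst.symm]; simp
      · exact fun h => absurd ht h
    · have key : ∀ s ∈ S, HasFDerivAt
          (fun z => (c s z ^ 2 * (3 - 2 * c s z)) • (v s + B s (z - s)))
          (if s = t then B t else 0) t := by
        intro s _
        have h1 : HasFDerivAt (fun z => v s + B s (z - s)) (B s) t := by
          have := ((B s).hasFDerivAt (x := t - s)).comp t ((hasFDerivAt_id t).sub_const s)
          exact this.const_add (v s)
        by_cases hst : s = t
        · subst hst
          refine ((cl_theta (hc s) s (Or.inr (hc1 s))).smul h1).congr_fderiv ?_
          ext z
          simp [hc1]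
          norm_num
        · refine ((cl_theta (hc s) t (Or.inl (hc0 s t ht (Ne.symm hst)))).smul h1).congr_fderiv ?_
          ext z
          simp [hst, hc0 s t ht (Ne.symm hst)]
      refine (HasFDerivAt.fun_sum key).congr_fderiv ?_
      simp [ht]

lemma cl_nhds_sub (f : Endo n) (W : Set (Endo n)) (hW : W ∈ 𝓝 f) :
    ∃ R ε : ℝ, 0 < ε ∧ ∀ g : Endo n, (∀ x, ‖x‖ ≤ R → ‖eapp g x - eapp f x‖ < ε) → g ∈ W := by
  rw [nhds_subtype_eq_comap, mem_comap] at hW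
  obtain ⟨T, hT, hTW⟩ := hW
  rw [UniformSpace.mem_nhds_iff] at hT
  obtain ⟨X, hX, hXT⟩ := hT
  rw [ContinuousMap.mem_compactConvergence_entourage_iff] at hX
  obtain ⟨L, Y, hL, hY, hLY⟩ := hX
  obtain ⟨ε, hε, hεY⟩ := Metric.mem_uniformity_dist.1 hY
  obtain ⟨R, hR⟩ := hL.isBounded.subset_closedBall (0 : Cn n)
  refine ⟨R, ε, hε, fun g hg => hTW (hXT (hLY ?_))⟩
  intro x hx
  apply hεY
  have := hg x (by simpa using hR hx)
  rw [dist_comm, dist_eq_norm]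
  exact this

lemma cl_nhds_mem (f : Endo n) (R ε : ℝ) (hε : 0 < ε) :
    {g : Endo n | ∀ x, ‖x‖ ≤ R → ‖eapp g x - eapp f x‖ < ε} ∈ 𝓝 f := by
  rw [nhds_subtype_eq_comap, mem_comap]
  refine ⟨{g | ∀ x ∈ closedBall (0 : Cn n) R, dist (f.1 x) (g x) < ε}, ?_, ?_⟩
  · rw [UniformSpace.mem_nhds_iff]
    refine ⟨{fg | ∀ x ∈ closedBall (0 : Cn n) R, dist (fg.1 x) (fg.2 x) < ε}, ?_, ?_⟩
    · rw [ContinuousMap.mem_compactConvergence_entourage_iff]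
      exact ⟨closedBall 0 R, {p | dist p.1 p.2 < ε}, isCompact_closedBall _ _,
        Metric.dist_mem_uniformity hε, fun _ h => h⟩
    · intro g hg
      exact hg
  · intro g hg x hx
    have := hg x (by simpa using hx)
    rw [dist_comm, dist_eq_norm] at this
    exact this

/-- derivative of iterates along an orbit -/
def clT (D : ℕ → (Cn n →L[ℂ] Cn n)) : ℕ → (Cn n →L[ℂ] Cn n)
  | 0 => 1
  | k + 1 => D k * clT D k

lemma clT_unit (D : ℕ → (Cn n →L[ℂ] Cn n)) (k : ℕ) (h : ∀ i < k, IsUnit (D i)) :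
    IsUnit (clT D k) := by
  induction k with
  | zero => exact isUnit_one
  | succ k ih => exact (h k (by omega)).mul (ih fun i hi => h i (by omega))

lemma clT_deriv (D : ℕ → (Cn n →L[ℂ] Cn n)) (x : ℕ → Cn n) (h : Cn n → Cn n) (k : ℕ)
    (hx : ∀ i < k, h (x i) = x (i + 1)) (hD : ∀ i < k, HasFDerivAt h (D i) (x i)) :
    h^[k] (x 0) = x k ∧ HasFDerivAt h^[k] (clT D k) (x 0) := by
  induction k with
  | zero => exact ⟨rfl, hasFDerivAt_id _⟩
  | succ k ih =>
    obtain ⟨h1, h2⟩ := ih (fun i hi => hx i (by omega)) (fun i hi => hD i (by omega))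
    rw [Function.iterate_succ']
    refine ⟨by simp [h1, hx], ?_⟩
    have := hD k (by omega)
    rw [← h1] at this
    exact this.comp (x 0) h2

lemma cl_eta (D : Cn n →L[ℂ] Cn n) : ∀ᶠ η in 𝓝[≠] (0 : ℂ), IsUnit (D + η • 1) := by
  have hfin : (spectrum ℂ (-D)).Finite := by
    have := Module.End.finite_spectrum ((Module.End.toContinuousLinearMap (𝕜 := ℂ) (Cn n)).symm (-D))
    rwa [AlgEquiv.spectrum_eq] at this
  have h1 : (spectrum ℂ (-D) \ {0})ᶜ ∈ 𝓝 (0 : ℂ) :=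
    (hfin.subset Set.sdiff_subset).isClosed.isOpen_compl.mem_nhds (by simp)
  filter_upwards [nhdsWithin_le_nhds h1, self_mem_nhdsWithin] with η h2 h3
  have h4 : η ∉ spectrum ℂ (-D) := fun h => h2 ⟨h, h3⟩
  rw [spectrum.notMem_iff] at h4
  rw [Algebra.algebraMap_eq_smul_one, sub_neg_eq_add, add_comm] at h4
  exact h4

/-- bundling -/
def clMk (h : Cn n → Cn n) (hh : Differentiable ℂ h) : Endo n := ⟨⟨h, hh.continuous⟩, hh⟩

lemma cl_psi (y : Cn n) (R ε : ℝ) (hR : R < ‖y‖) (hR0 : 0 ≤ R) (hε : 0 < ε) :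
    ∃ ψ : Cn n → ℂ, Differentiable ℂ ψ ∧ ψ y = 1 ∧ HasFDerivAt ψ (0 : Cn n →L[ℂ] ℂ) y ∧
      ∀ x, ‖x‖ ≤ R → ‖ψ x‖ < ε := by
  have hy : 0 < ‖y‖ := hR0.trans_lt hR
  set δ : ℝ := ‖y‖ * (‖y‖ - R) with hδ
  have hδ0 : 0 < δ := mul_pos hy (sub_pos.2 hR)
  obtain ⟨N, hN0, hN⟩ : ∃ N : ℝ, 0 ≤ N ∧ Real.exp (-(N * δ)) < min 1 (ε / 5) := by
    have h1 : Tendsto (fun N : ℝ => Real.exp (-(N * δ))) atTop (𝓝 0) :=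
      Real.tendsto_exp_neg_atTop_nhds_zero.comp (tendsto_id.atTop_mul_const hδ0)
    have h2 : (0 : ℝ) < min 1 (ε / 5) := by positivity
    obtain ⟨N, hN, hN0⟩ := ((h1.eventually (gt_mem_nhds h2)).and (eventually_ge_atTop 0)).exists
    exact ⟨N, hN0, hN⟩
  let c : Cn n → ℂ := fun z => Complex.exp ((N : ℂ) * (innerSL ℂ y (z - y)))
  have hc : Differentiable ℂ c := by
    have : Differentiable ℂ (fun z => innerSL ℂ y (z - y)) := by fun_prop
    exact (this.const_mul (N : ℂ)).cexp
  have hcy : c y = 1 := by simp [c]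
  refine ⟨fun z => c z ^ 2 * (3 - 2 * c z), ?_, ?_, cl_theta hc y (Or.inr hcy), ?_⟩
  · fun_prop
  · simp only [hcy]; norm_num
  · intro x hx
    have h1 : ‖c x‖ ≤ Real.exp (-(N * δ)) := by
      simp only [c, Complex.norm_exp]
      apply Real.exp_le_exp.2
      rw [Complex.re_ofReal_mul, ← mul_neg]
      apply mul_le_mul_of_nonneg_left _ hN0
      have h2 : innerSL ℂ y (x - y) = inner ℂ y x - inner ℂ y y := by
        rw [innerSL_apply_apply, inner_sub_right]
      have h3 : (inner ℂ y y : ℂ).re = ‖y‖ ^ 2 :=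
        inner_self_eq_norm_sq (𝕜 := ℂ) y
      have h4 : (inner ℂ y x : ℂ).re ≤ ‖y‖ * ‖x‖ :=
        (Complex.re_le_norm _).trans (norm_inner_le_norm y x)
      rw [h2, Complex.sub_re, h3, hδ]
      nlinarith
    have h2 : ‖c x‖ < 1 := h1.trans_lt (hN.trans_le (min_le_left _ _))
    have h3 : ‖c x‖ < ε / 5 := h1.trans_lt (hN.trans_le (min_le_right _ _))
    have h4 : ‖(3 : ℂ) - 2 * c x‖ ≤ 5 := by
      refine (norm_sub_le _ _).trans ?_
      rw [norm_mul]
      norm_num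
      linarith
    rw [norm_mul, norm_pow]
    have h0 := norm_nonneg (c x)
    calc ‖c x‖ ^ 2 * ‖(3 : ℂ) - 2 * c x‖ ≤ ‖c x‖ * 5 := by
          apply mul_le_mul _ h4 (norm_nonneg _) h0
          nlinarith
      _ < ε := by linarith

lemma cl_bound (F : Cn n → Cn n) (hF : Differentiable ℂ F) (R : ℝ) :
    ∃ C : ℝ, 0 < C ∧ ∀ x, ‖x‖ ≤ R → ‖F x‖ ≤ C := by
  obtain ⟨C, hC⟩ := (isCompact_closedBall (0 : Cn n) R).exists_bound_of_continuousOn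
    hF.continuous.continuousOn
  refine ⟨max C 1, by positivity, fun x hx => (hC x (by simpa using hx)).trans (le_max_left _ _)⟩

lemma cl_main (f : Endo n) (K : Set (Cn n)) (hK : IsCompact K)
    (p : Cn n) (hp : p ∉ rne f) (W : Set (Endo n)) (hW : W ∈ 𝓝 f)
    (V : Set (Cn n)) (hV : V ∈ 𝓝 p) (M : Cn n →L[ℂ] Cn n) :
    ∃ h ∈ W, ∃ q ∈ V, IsPer h q ∧ fderiv ℂ ((eapp h)^[minPer h q]) q = M ∧
      ∃ j : ℕ, (eapp h)^[j] q ∉ K := by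
  classical
  obtain ⟨R0, ε, hε, hRW⟩ := cl_nhds_sub f W hW
  obtain ⟨R1, hR1⟩ := hK.isBounded.subset_closedBall (0 : Cn n)
  obtain ⟨R, hRR0, hRR1, hRp⟩ : ∃ R, R0 ≤ R ∧ R1 ≤ R ∧ ‖p‖ < R :=
    ⟨max (max R0 R1) (‖p‖ + 1), by simp, by simp, by simp⟩
  have hR0 : 0 ≤ R := (norm_nonneg p).trans hRp.le
  obtain ⟨g, hgf, x0, hx0, j0, hj0⟩ : ∃ g : Endo n,
      (∀ x, ‖x‖ ≤ R → ‖eapp g x - eapp f x‖ < ε / 3) ∧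
      ∃ x0 ∈ interior V ∩ ball 0 R, ∃ j, R < ‖(eapp g)^[j] x0‖ := by
    by_contra hcon
    push Not at hcon
    refine hp ⟨interior V ∩ ball 0 R, isOpen_interior.inter isOpen_ball,
      ⟨mem_interior_iff_mem_nhds.2 hV, by simpa using hRp⟩, _,
      cl_nhds_mem f R (ε / 3) (by positivity), closedBall 0 R, isCompact_closedBall _ _, ?_⟩
    rintro g hg j _ ⟨y, hy, rfl⟩
    simpa using hcon g hg y hy j
  obtain ⟨j, hj, hmin⟩ : ∃ j, R < ‖(eapp g)^[j] x0‖ ∧ ∀ i < j, ‖(eapp g)^[i] x0‖ ≤ R := by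
    have hex : ∃ j, R < ‖(eapp g)^[j] x0‖ := ⟨j0, hj0⟩
    exact ⟨Nat.find hex, Nat.find_spec hex, fun i hi => not_lt.1 (Nat.find_min hex hi)⟩
  have hGd : Differentiable ℂ (eapp g) := g.2
  set G := eapp g with hG
  set x : ℕ → Cn n := fun k => G^[k] x0 with hx
  have hxs : ∀ i, G (x i) = x (i + 1) := fun i => (Function.iterate_succ_apply' G i x0).symm
  have hxadd : ∀ a b, x (a + b) = G^[a] (x b) := fun a b => Function.iterate_add_apply G a b x0
  have hinj : ∀ a b, a < b → b ≤ j → x a ≠ x b := by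
    intro a b hab hbj heq
    have h1 : x ((j - b) + a) = x ((j - b) + b) := by rw [hxadd, hxadd, heq]
    rw [Nat.sub_add_cancel hbj] at h1
    have h2 := hmin ((j - b) + a) (by omega)
    change ‖x _‖ ≤ R at h2
    rw [h1] at h2
    exact absurd hj (not_lt.2 h2)
  let S : Finset (Cn n) := (Finset.range (j + 1)).image x
  have hS : ∀ i ≤ j, x i ∈ S := fun i hi =>
    Finset.mem_image_of_mem x (Finset.mem_range.2 (by omega))
  obtain ⟨Q, hQd, hQ⟩ := cl_interp S (fun _ => 0) (fun _ => 1)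
  obtain ⟨C, hC0, hC⟩ := cl_bound Q hQd R
  obtain ⟨η, hη1, hη2⟩ : ∃ η : ℂ, (∀ i < j, IsUnit (fderiv ℂ G (x i) + η • 1)) ∧
      ‖η‖ < ε / 3 / C := by
    have e1 : ∀ᶠ η in 𝓝[≠] (0 : ℂ), ∀ i ∈ Finset.range j,
        IsUnit (fderiv ℂ G (x i) + η • 1) :=
      (Filter.eventually_all_finset _).2 fun i _ => cl_eta _
    have e2 : ∀ᶠ η in 𝓝[≠] (0 : ℂ), ‖η‖ < ε / 3 / C := by
      apply nhdsWithin_le_nhds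
      have : ball (0 : ℂ) (ε / 3 / C) ∈ 𝓝 (0 : ℂ) := ball_mem_nhds _ (by positivity)
      filter_upwards [this] with η h
      simpa using h
    obtain ⟨η, h1, h2⟩ := (e1.and e2).exists
    exact ⟨η, fun i hi => h1 i (Finset.mem_range.2 hi), h2⟩
  let D : ℕ → (Cn n →L[ℂ] Cn n) := fun i => fderiv ℂ G (x i) + η • 1
  let g1 : Cn n → Cn n := fun z => G z + η • Q z
  have hg1d : Differentiable ℂ g1 := hGd.add (hQd.const_smul η)
  have hg1x : ∀ i ≤ j, g1 (x i) = x (i + 1) := by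
    intro i hi
    simp only [g1, (hQ _ (hS i hi)).1, smul_zero, add_zero, hxs]
  have hg1D : ∀ i ≤ j, HasFDerivAt g1 (D i) (x i) := fun i hi =>
    (hGd (x i)).hasFDerivAt.add ((hQ _ (hS i hi)).2.const_smul η)
  have hg1b : ∀ z, ‖z‖ ≤ R → ‖g1 z - G z‖ < ε / 3 := by
    intro z hz
    simp only [g1, add_sub_cancel_left, norm_smul]
    calc ‖η‖ * ‖Q z‖ ≤ ‖η‖ * C := mul_le_mul_of_nonneg_left (hC z hz) (norm_nonneg _)
      _ < ε / 3 / C * C := mul_lt_mul_of_pos_right hη2 hC0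
      _ = ε / 3 := by field_simp
  obtain ⟨u, hu⟩ := clT_unit D j hη1
  obtain ⟨F, hFd, hF⟩ := cl_interp S (fun s => if s = x j then x 0 - g1 (x j) else 0)
    (fun s => if s = x j then M * (↑u⁻¹ : Cn n →L[ℂ] Cn n) - D j else 0)
  obtain ⟨C', hC0', hC'⟩ := cl_bound F hFd R
  obtain ⟨ψ, hψd, hψ1, hψ', hψb⟩ := cl_psi (x j) R (ε / 3 / C') hj hR0 (by positivity)
  let h : Cn n → Cn n := fun z => g1 z + ψ z • F z
  have hhd : Differentiable ℂ h := hg1d.add (hψd.smul hFd)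
  have hF1 : ∀ i < j, F (x i) = 0 ∧ HasFDerivAt F (0 : Cn n →L[ℂ] Cn n) (x i) := by
    intro i hi
    have := hF _ (hS i hi.le)
    simpa only [if_neg (hinj i j hi le_rfl)] using this
  have hF2 : F (x j) = x 0 - g1 (x j) ∧
      HasFDerivAt F (M * (↑u⁻¹ : Cn n →L[ℂ] Cn n) - D j) (x j) := by
    have := hF _ (hS j le_rfl)
    simpa only [if_true] using this
  have hhx : ∀ i < j, h (x i) = x (i + 1) := by
    intro i hi
    simp only [h, (hF1 i hi).1, smul_zero, add_zero, hg1x i hi.le]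
  have hhD : ∀ i < j, HasFDerivAt h (D i) (x i) := by
    intro i hi
    refine ((hg1D i hi.le).add ((hψd (x i)).hasFDerivAt.smul (hF1 i hi).2)).congr_fderiv ?_
    ext1 z
    simp [(hF1 i hi).1]
  have hhxj : h (x j) = x 0 := by
    simp only [h, hF2.1, hψ1, one_smul, add_sub_cancel]
  have hhDj : HasFDerivAt h (M * (↑u⁻¹ : Cn n →L[ℂ] Cn n)) (x j) := by
    refine ((hg1D j le_rfl).add (hψ'.smul hF2.2)).congr_fderiv ?_
    ext1 z
    simp [hψ1]
  have hhb : ∀ z, ‖z‖ ≤ R → ‖h z - g1 z‖ < ε / 3 := by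
    intro z hz
    simp only [h, add_sub_cancel_left, norm_smul]
    calc ‖ψ z‖ * ‖F z‖ ≤ ‖ψ z‖ * C' := mul_le_mul_of_nonneg_left (hC' z hz) (norm_nonneg _)
      _ < ε / 3 / C' * C' := mul_lt_mul_of_pos_right (hψb z hz) hC0'
      _ = ε / 3 := by field_simp
  have hit : ∀ k ≤ j, h^[k] (x 0) = x k ∧ HasFDerivAt h^[k] (clT D k) (x 0) := fun k hk =>
    clT_deriv D x h k (fun i hi => hhx i (by omega)) (fun i hi => hhD i (by omega))
  have hper : h^[j + 1] (x 0) = x 0 := by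
    rw [Function.iterate_succ_apply', (hit j le_rfl).1, hhxj]
  have hder : HasFDerivAt h^[j + 1] M (x 0) := by
    rw [Function.iterate_succ']
    have h1 := hhDj
    rw [← (hit j le_rfl).1] at h1
    refine (h1.comp (x 0) (hit j le_rfl).2).congr_fderiv ?_
    rw [← hu]
    change M * (↑u⁻¹ : Cn n →L[ℂ] Cn n) * ↑u = M
    rw [mul_assoc, Units.inv_mul, mul_one]
  have hminper : Function.minimalPeriod h (x 0) = j + 1 := by
    have h1 : Function.IsPeriodicPt h (j + 1) (x 0) := hper
    have h2 := h1.minimalPeriod_le (Nat.succ_pos j)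
    have h3 := h1.minimalPeriod_pos (Nat.succ_pos j)
    have h4 : h^[Function.minimalPeriod h (x 0)] (x 0) = x 0 :=
      Function.iterate_minimalPeriod
    by_contra hne
    have h5 : Function.minimalPeriod h (x 0) ≤ j := by omega
    rw [(hit _ h5).1] at h4
    exact hinj 0 _ h3 h5 h4.symm
  refine ⟨clMk h hhd, ?_, x 0, interior_subset hx0.1, ⟨j + 1, by omega, hper⟩, ?_, j, ?_⟩
  · apply hRW
    intro z hz
    have hz' := hz.trans hRR0
    have h1 := hgf z hz'
    have h2 := hg1b z hz'
    have h3 := hhb z hz'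
    have h4 : eapp (clMk h hhd) z - eapp f z
        = (h z - g1 z) + (g1 z - G z) + (G z - eapp f z) := by
      change h z - _ = _
      abel
    rw [h4]
    refine (norm_add₃_le).trans_lt ?_
    linarith
  · change fderiv ℂ (h^[Function.minimalPeriod h (x 0)]) (x 0) = M
    rw [hminper]
    exact hder.fderiv
  · change h^[j] (x 0) ∉ K
    rw [(hit j le_rfl).1]
    intro hk
    have := hR1 hk
    rw [mem_closedBall_zero_iff] at this
    exact absurd hj (not_lt.2 (this.trans hRR1))

/-- The closing lemma: near any point outside `rne(f)` one can create super-attracting,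
repelling, and (if `n ≥ 2`) saddle periodic points whose orbit leaves `K`, by an arbitrarily
small perturbation of `f`. -/
theorem stmt_5 (n : ℕ) (hn : 1 ≤ n) (f : Endo n) (K : Set (Cn n)) (hK : IsCompact K)
    (p : Cn n) (hp : p ∉ rne f) (W : Set (Endo n)) (hW : W ∈ 𝓝 f)
    (V : Set (Cn n)) (hV : V ∈ 𝓝 p) :
    (∃ h ∈ W, ∃ q ∈ V, IsSuperAttPer h q ∧ ∃ j : ℕ, (eapp h)^[j] q ∉ K) ∧
    (∃ h ∈ W, ∃ q ∈ V, IsRepPer h q ∧ ∃ j : ℕ, (eapp h)^[j] q ∉ K) ∧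
    (2 ≤ n → ∃ h ∈ W, ∃ q ∈ V, IsSadPer h q ∧ ∃ j : ℕ, (eapp h)^[j] q ∉ K) := by
  refine ⟨?_, ?_, ?_⟩
  · obtain ⟨h, hW', q, hq, h1, h2, h3⟩ := cl_main f K hK p hp W hW V hV 0
    exact ⟨h, hW', q, hq, ⟨h1, h2⟩, h3⟩
  · obtain ⟨h, hW', q, hq, h1, h2, h3⟩ := cl_main f K hK p hp W hW V hV
      (Matrix.toEuclideanCLM (n := Fin n) (𝕜 := ℂ) (Matrix.diagonal fun _ => 2))
    refine ⟨h, hW', q, hq, ⟨h1, ?_⟩, h3⟩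
    intro z hz
    rw [eigs, h2, AlgEquiv.spectrum_eq, spectrum_diagonal] at hz
    obtain ⟨i, rfl⟩ := hz
    norm_num
  · intro hn2
    obtain ⟨h, hW', q, hq, h1, h2, h3⟩ := cl_main f K hK p hp W hW V hV
      (Matrix.toEuclideanCLM (n := Fin n) (𝕜 := ℂ)
        (Matrix.diagonal fun i => if (i : ℕ) = 0 then 2 else 1 / 2))
    have he : eigs h q = Set.range fun i : Fin n => if (i : ℕ) = 0 then (2 : ℂ) else 1 / 2 := by
      rw [eigs, h2, AlgEquiv.spectrum_eq, spectrum_diagonal]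
    refine ⟨h, hW', q, hq, ⟨⟨h1, ?_⟩, ?_, ?_⟩, h3⟩
    · rw [he]
      rintro _ ⟨i, rfl⟩
      beta_reduce
      split_ifs <;> norm_num
    · rw [he]
      exact ⟨_, ⟨⟨1, by omega⟩, rfl⟩, by norm_num⟩
    · rw [he]
      exact ⟨_, ⟨⟨0, by omega⟩, rfl⟩, by norm_num⟩
end
end

section
/- For a generic endomorphism f of ℂⁿ (n ≥ 1), the Fatou set equals the robustly non-expelling set: F_f = rne(f). Moreover, F_f is exactly the set of points p ∈ ℂⁿ for which there exist an open neighbourhood V of p and a compact subset K of ℂⁿ with f^[k](V) ⊆ K for all k ≥ 1. (Proposition 2.9 of the paper, proved for Oka-Stein manifolds; specialized to ℂⁿ.) -/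
open Function Topology Filter Metric

noncomputable section

variable {n : ℕ}

lemma diff_of_unif {F : ℕ → Cn n → Cn n} {g : Cn n → Cn n} {p : Cn n} {ρ : ℝ}
    (hF : ∀ k, Differentiable ℂ (F k)) (h : TendstoUniformlyOn F g atTop (ball p ρ)) :
    DifferentiableOn ℂ g (ball p ρ) := by
  intro x hx
  obtain ⟨r, hr, hsub⟩ : ∃ r > 0, ball x (2 * r) ⊆ ball p ρ := by
    obtain ⟨e, he, h1⟩ := Metric.isOpen_iff.1 isOpen_ball x hx
    exact ⟨e / 2, by positivity, by simpa [mul_div_cancel₀] using h1⟩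
  have hC : UniformCauchySeqOn (fun k => fderiv ℂ (F k)) atTop (ball x r) := by
    rw [Metric.uniformCauchySeqOn_iff]
    intro ε hε
    obtain ⟨N, hN⟩ := Metric.uniformCauchySeqOn_iff.1 h.uniformCauchySeqOn (ε * r / 4)
      (by positivity)
    refine ⟨N, fun k hk m hm y hy => ?_⟩
    have hb : ∀ z ∈ ball y r, ‖F k z - F m z‖ < ε * r / 4 := by
      intro z hz
      rw [← dist_eq_norm]
      refine hN k hk m hm z (hsub ?_)
      rw [mem_ball] at *
      linarith [dist_triangle z y x]
    have h1 := Complex.norm_fderiv_le_div_of_mapsTo_ball (f := fun z => F k z - F m z) (c := y)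
      (R₁ := r) (R₂ := ε * r / 2) ((hF k).sub (hF m)).differentiableOn (by
        intro z hz
        rw [mem_closedBall, dist_eq_norm]
        have h2 := hb z hz
        have h3 := hb y (mem_ball_self hr)
        have := norm_sub_le (F k z - F m z) (F k y - F m y)
        linarith) hr
    have h4 : fderiv ℂ (fun z => F k z - F m z) y = fderiv ℂ (F k) y - fderiv ℂ (F m) y :=
      fderiv_fun_sub (hF k y) (hF m y)
    rw [dist_eq_norm, ← h4]
    refine h1.trans_lt ?_
    rw [div_lt_iff₀ hr]
    nlinarith [mul_pos hε hr]
  have hlim : ∀ y ∈ ball x r, ∃ A, Tendsto (fun k => fderiv ℂ (F k) y) atTop (𝓝 A) := by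
    intro y hy
    exact cauchySeq_tendsto_of_complete (hC.cauchySeq hy)
  choose! g' hg' using hlim
  have hU := hC.tendstoUniformlyOn_of_tendsto hg'
  refine DifferentiableAt.differentiableWithinAt (HasFDerivAt.differentiableAt (f' := g' x) ?_)
  refine hasFDerivAt_of_tendstoUniformlyOn isOpen_ball hU
    (fun k y _ => (hF k y).hasFDerivAt) (fun y hy => ?_) (mem_ball_self hr)
  exact h.tendsto_at (hsub (ball_subset_ball (by linarith) hy))

lemma montel {F : ℕ → Cn n → Cn n} {p : Cn n} {ρ M : ℝ} (hρ : 0 < ρ)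
    (hF : ∀ k, Differentiable ℂ (F k)) (hM : ∀ k, ∀ x ∈ ball p ρ, ‖F k x‖ ≤ M) :
    ∃ l : ℕ → ℕ, StrictMono l ∧ ∃ g : Cn n → Cn n, DifferentiableOn ℂ g (ball p (ρ / 2)) ∧
      TendstoUniformlyOn (fun j => F (l j)) g atTop (ball p (ρ / 2)) := by
  classical
  let X := closedBall p (ρ / 2)
  have : CompactSpace X := isCompact_iff_compactSpace.1 (isCompact_closedBall _ _)
  let G : ℕ → BoundedContinuousFunction X (Cn n) := fun k =>
    BoundedContinuousFunction.mkOfCompact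
      ⟨fun x => F k x, (hF k).continuous.comp continuous_subtype_val⟩
  have hG : ∀ k x, G k x = F k x := fun k x => rfl
  have hX : ∀ x ∈ X, x ∈ ball p ρ := fun x hx => by
    have : dist x p ≤ ρ / 2 := hx
    rw [mem_ball]; linarith
  have hc : IsCompact (closure (Set.range G)) := by
    refine BoundedContinuousFunction.arzela_ascoli (closedBall 0 M) (isCompact_closedBall _ _) _
      ?_ ?_
    · rintro _ x ⟨k, rfl⟩
      rw [hG, mem_closedBall_zero_iff]
      exact hM k x (hX x x.2)
    · intro x
      refine Metric.equicontinuousAt_of_continuity_modulus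
        (fun z => 2 * M / (ρ / 2) * dist z x) ?_ _ ?_
      · have : Continuous fun z : X => 2 * M / (ρ / 2) * dist z x := by fun_prop
        simpa using this.tendsto x
      · filter_upwards [ball_mem_nhds x (half_pos hρ)] with z hz
        rintro ⟨_, k, rfl⟩
        show dist (F k x) (F k z) ≤ _
        rw [dist_comm]
        have hs : ∀ w ∈ ball (x : Cn n) (ρ / 2), w ∈ ball p ρ := by
          intro w hw
          have h2 : dist (x : Cn n) p ≤ ρ / 2 := x.2
          rw [mem_ball] at *
          linarith [dist_triangle w x p]
        refine Complex.dist_le_div_mul_dist_of_mapsTo_ball (hF k).differentiableOn ?_ hz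
        intro w hw
        rw [mem_closedBall, dist_eq_norm]
        have h2 := hM k w (hs w hw)
        have h3 := hM k x (hX x x.2)
        linarith [norm_sub_le (F k w) (F k x)]
  obtain ⟨φ, -, l, hl, hlim⟩ := hc.tendsto_subseq (x := G)
    (fun k => subset_closure (Set.mem_range_self k))
  have hu := BoundedContinuousFunction.tendsto_iff_tendstoUniformly.1 hlim
  have hT : TendstoUniformlyOn (fun j => F (l j))
      (fun x => if h : x ∈ X then φ ⟨x, h⟩ else 0) atTop (ball p (ρ / 2)) := by
    rw [Metric.tendstoUniformlyOn_iff]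
    intro ε hε
    filter_upwards [Metric.tendstoUniformly_iff.1 hu ε hε] with j hj x hx
    have hx' : x ∈ X := ball_subset_closedBall hx
    have := hj ⟨x, hx'⟩
    rw [Function.comp_apply, hG] at this
    simpa only [hx', dif_pos] using this
  exact ⟨l, hl, _, diff_of_unif (fun k => hF (l k)) hT, hT⟩

lemma iter_diff (f : Endo n) (k : ℕ) : Differentiable ℂ ((eapp f)^[k]) := f.2.iterate k

lemma fatou_of_bdd (f : Endo n) (p : Cn n) (V : Set (Cn n)) (hV : IsOpen V) (hp : p ∈ V)
    (K : Set (Cn n)) (hK : IsCompact K) (h : ∀ k : ℕ, 1 ≤ k → (eapp f)^[k] '' V ⊆ K) :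
    FatouAt f p := by
  obtain ⟨ρ, hρ, hb⟩ := Metric.isOpen_iff.1 hV p hp
  obtain ⟨M, hM⟩ := (hK.union (isCompact_closedBall p ρ)).isBounded.exists_norm_le
  have hbd : ∀ k : ℕ, ∀ x ∈ ball p ρ, ‖(eapp f)^[k] x‖ ≤ M := by
    intro k x hx
    apply hM
    rcases Nat.eq_zero_or_pos k with rfl | hk
    · exact Or.inr (ball_subset_closedBall hx)
    · exact Or.inl (h k hk ⟨x, hb hx, rfl⟩)
  refine ⟨ball p (ρ / 2), isOpen_ball, mem_ball_self (half_pos hρ), fun k hk => ?_⟩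
  obtain ⟨l, hl, g, hg, ht⟩ := montel (F := fun j => (eapp f)^[k j]) hρ
    (fun j => iter_diff f _) (fun j => hbd _)
  exact ⟨l, hl, Or.inl ⟨g, hg, ht.tendstoLocallyUniformlyOn⟩⟩

lemma iter_cont (j : ℕ) (x : Cn n) : Continuous fun f : Endo n => (eapp f)^[j] x := by
  induction j with
  | zero => exact continuous_const
  | succ j ih =>
    simp only [Function.iterate_succ_apply']
    exact Continuous.eval continuous_subtype_val ih

/-- Maps with a trapping ball that is reached from `U`. -/
def trapSet (U : Set (Cn n)) : Set (Endo n) :=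
  {f | ∃ (j : ℕ) (a : Cn n) (δ : ℝ), Set.MapsTo (eapp f) (closedBall a δ) (ball a δ) ∧
    ∃ x ∈ U, (eapp f)^[j] x ∈ ball a δ}

lemma isOpen_trapSet (U : Set (Cn n)) : IsOpen (trapSet U) := by
  rw [isOpen_iff_mem_nhds]
  rintro f ⟨j, a, δ, hm, x, hx, hj⟩
  have h1 : ∀ᶠ g : Endo n in 𝓝 f, Set.MapsTo (eapp g) (closedBall a δ) (ball a δ) :=
    (continuous_subtype_val.tendsto f).eventually
      (ContinuousMap.eventually_mapsTo (isCompact_closedBall a δ) isOpen_ball hm)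
  have h2 : ∀ᶠ g : Endo n in 𝓝 f, (eapp g)^[j] x ∈ ball a δ :=
    ((iter_cont j x).tendsto f).eventually (isOpen_ball.mem_nhds hj)
  filter_upwards [h1, h2] with g hg1 hg2
  exact ⟨j, a, δ, hg1, x, hx, hg2⟩

lemma trap_bdd {U : Set (Cn n)} {f : Endo n} (h : f ∈ trapSet U) :
    ∃ x ∈ U, ∃ (j : ℕ) (a : Cn n) (δ : ℝ), ∀ k ≥ j, (eapp f)^[k] x ∈ closedBall a δ := by
  obtain ⟨j, a, δ, hm, x, hx, hj⟩ := h
  refine ⟨x, hx, j, a, δ, fun k hk => ?_⟩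
  induction k, hk using Nat.le_induction with
  | base => exact ball_subset_closedBall hj
  | succ k hk ih =>
    rw [Function.iterate_succ_apply']
    exact ball_subset_closedBall (hm ih)

lemma nhds_endo {f : Endo n} {V : Set (Endo n)} (hV : V ∈ 𝓝 f) :
    ∃ R : ℝ, 0 < R ∧ ∃ ε > 0, ∀ g : Endo n,
      (∀ x, ‖x‖ ≤ R → ‖eapp g x - eapp f x‖ < ε) → g ∈ V := by
  rw [nhds_subtype_eq_comap, mem_comap] at hV
  obtain ⟨T, hT, hTV⟩ := hV
  have hb := Metric.uniformity_basis_dist (α := Cn n)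
  have hbas := nhds_basis_uniformity' (hb.compactConvergenceUniformity (α := Cn n)) (x := f.1)
  obtain ⟨⟨K, ε⟩, ⟨hK, hε⟩, hsub⟩ := hbas.mem_iff.1 hT
  obtain ⟨R, hR0, hR⟩ := hK.isBounded.exists_pos_norm_le
  refine ⟨R, hR0, ε, hε, fun g hg => hTV (hsub ?_)⟩
  intro x hx
  have := hg x (hR x hx)
  rw [← dist_eq_norm, dist_comm] at this
  exact this

lemma perturb {U : Set (Cn n)} {f : Endo n} {q : Cn n} (hq : q ∈ U)
    (hunb : ∀ R : ℝ, ∃ j : ℕ, R < ‖(eapp f)^[j] q‖) : f ∈ closure (trapSet U) := by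
  classical
  rw [mem_closure_iff_nhds]
  intro V hV
  obtain ⟨R, hR, ε, hε, hV⟩ := nhds_endo hV
  let j := Nat.find (hunb R)
  have hj : R < ‖(eapp f)^[j] q‖ := Nat.find_spec (hunb R)
  have hjm : ∀ i < j, ‖(eapp f)^[i] q‖ ≤ R := fun i hi => not_lt.1 (Nat.find_min (hunb R) hi)
  generalize ha : (eapp f)^[j] q = a at hj
  have ha0 : 0 < ‖a‖ := hR.trans hj
  have ha0' : (‖a‖ : ℂ) ≠ 0 := by exact_mod_cast ha0.ne'
  let u : Cn n → ℂ := fun z => inner ℂ a z / (‖a‖ : ℂ) ^ 2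
  have hud : Differentiable ℂ u := by
    have h0 : Differentiable ℂ fun z => innerSL ℂ a z := (innerSL ℂ a).differentiable
    simp only [u, div_eq_mul_inv]
    exact h0.mul_const _
  have hua : u a = 1 := by
    simp only [u, inner_self_eq_norm_sq_to_K]
    exact div_self (pow_ne_zero 2 ha0')
  let r := R / ‖a‖
  have hr0 : 0 ≤ r := by positivity
  have hr1 : r < 1 := (div_lt_one ha0).2 hj
  have hur : ∀ z, ‖z‖ ≤ R → ‖u z‖ ≤ r := by
    intro z hz
    simp only [u, r, norm_div, norm_pow, Complex.norm_real, norm_norm]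
    rw [div_le_div_iff₀ (by positivity) ha0]
    have := norm_inner_le_norm (𝕜 := ℂ) a z
    calc ‖inner ℂ a z‖ * ‖a‖ ≤ (‖a‖ * ‖z‖) * ‖a‖ := by gcongr
      _ ≤ (‖a‖ * R) * ‖a‖ := by gcongr
      _ = R * ‖a‖ ^ 2 := by ring
  let P : Cn n → ℂ := fun z => ∏ i ∈ Finset.range j, (u z - u ((eapp f)^[i] q))
  have hPd : Differentiable ℂ P := by
    have hP' : ∀ m : ℕ, Differentiable ℂ
        fun z => ∏ i ∈ Finset.range m, (u z - u ((eapp f)^[i] q)) := by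
      intro m
      induction m with
      | zero => simp
      | succ m ih =>
        simp only [Finset.prod_range_succ]
        exact ih.mul (hud.sub_const _)
    exact hP' j
  have hPa : P a ≠ 0 := by
    refine Finset.prod_ne_zero_iff.2 fun i hi => ?_
    intro h0
    have h1 := hur _ (hjm i (Finset.mem_range.1 hi))
    rw [← sub_eq_zero.1 h0, hua, norm_one] at h1
    linarith
  have hPz : ∀ i < j, P ((eapp f)^[i] q) = 0 := fun i hi =>
    Finset.prod_eq_zero (Finset.mem_range.2 hi) (sub_self _)
  let c : Cn n → ℂ := fun z => P z / P a
  have hcd : Differentiable ℂ c := by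
    simp only [c, div_eq_mul_inv]
    exact hPd.mul_const _
  obtain ⟨C, hC⟩ := (isCompact_closedBall (0 : Cn n) R).exists_bound_of_continuousOn
    hcd.continuous.continuousOn
  obtain ⟨M, hM⟩ := (isCompact_closedBall (0 : Cn n) R).exists_bound_of_continuousOn
    (f := fun z => eapp f z - a) (f.1.continuous.sub continuous_const).continuousOn
  have hlim : Tendsto (fun N : ℕ => ((r ^ N * C) ^ 2 + 2 * (r ^ N * C)) * M) atTop (𝓝 0) := by
    have h1 : Tendsto (fun N : ℕ => r ^ N * C) atTop (𝓝 0) := by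
      simpa using (tendsto_pow_atTop_nhds_zero_of_lt_one hr0 hr1).mul_const C
    simpa using ((h1.pow 2).add (h1.const_mul 2)).mul_const M
  obtain ⟨N, hN⟩ := (hlim.eventually (gt_mem_nhds hε)).exists
  let v : Cn n → ℂ := fun z => u z ^ N * c z
  have hvd : Differentiable ℂ v := (hud.pow N).mul hcd
  have hva : v a = 1 := by simp [v, c, hua, hPa]
  have hvz : ∀ i < j, v ((eapp f)^[i] q) = 0 := fun i hi => by simp [v, c, hPz i hi]
  let G : Cn n → Cn n := fun z => a + (1 - v z) ^ 2 • (eapp f z - a)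
  have hfd : Differentiable ℂ (eapp f) := f.2
  have hGd : Differentiable ℂ G := by
    have : Differentiable ℂ fun z => (1 - v z) ^ 2 • (eapp f z - a) :=
      ((hvd.const_sub 1).pow 2).smul (hfd.sub_const a)
    exact this.const_add a
  have hGa : G a = a := by simp [G, hva]
  have hGD : HasFDerivAt G (0 : Cn n →L[ℂ] Cn n) a := by
    have h1 := (((hvd a).hasFDerivAt.const_sub 1).pow 2).smul ((hfd a).hasFDerivAt.sub_const a)
    have h2 := h1.const_add a
    refine h2.congr_fderiv ?_
    ext z
    simp [hva]
  let g : Endo n := ⟨⟨G, hGd.continuous⟩, hGd⟩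
  have hgG : eapp g = G := rfl
  refine ⟨g, hV g ?_, ?_⟩
  · intro x hx
    have e1 : eapp g x - eapp f x = (v x ^ 2 - 2 * v x) • (eapp f x - a) := by
      rw [hgG]
      simp only [G]
      module
    have hx' : x ∈ closedBall (0 : Cn n) R := mem_closedBall_zero_iff.2 hx
    have hv : ‖v x‖ ≤ r ^ N * C := by
      simp only [v, norm_mul, norm_pow]
      exact mul_le_mul (pow_le_pow_left₀ (norm_nonneg _) (hur x hx) N) (hC x hx')
        (norm_nonneg _) (by positivity)
    have h0 : 0 ≤ r ^ N * C := (norm_nonneg _).trans hv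
    rw [e1, norm_smul]
    refine lt_of_le_of_lt ?_ hN
    refine mul_le_mul ?_ (hM x hx') (norm_nonneg _) (by positivity)
    refine (norm_sub_le _ _).trans ?_
    rw [norm_pow, norm_mul 2 (v x), Complex.norm_two]
    gcongr
  · have hit : ∀ i ≤ j, G^[i] q = (eapp f)^[i] q := by
      intro i
      induction i with
      | zero => intro _; rfl
      | succ i ih =>
        intro hi
        rw [Function.iterate_succ_apply', Function.iterate_succ_apply', ih (by omega)]
        simp [G, hvz i (by omega)]
    have h1 : ∀ᶠ z in 𝓝 a, ‖G z - G a - (0 : Cn n →L[ℂ] Cn n) (z - a)‖ ≤ (1 / 2) * ‖z - a‖ :=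
      hGD.isLittleO.def (by norm_num)
    obtain ⟨e, he, hb⟩ := Metric.eventually_nhds_iff.1 h1
    refine ⟨j, a, e / 2, ?_, q, hq, ?_⟩
    · intro z hz
      rw [mem_closedBall] at hz
      have h2 := hb (y := z) (by linarith)
      rw [hGa, ← dist_eq_norm z a] at h2
      simp only [ContinuousLinearMap.zero_apply, sub_zero] at h2
      rw [hgG, mem_ball, dist_eq_norm]
      linarith
    · rw [hgG, hit j le_rfl, ha]
      exact mem_ball_self (half_pos he)

/-- Maps expelling some point of `U` from the ball of radius `M`. -/
def expSet (U : Set (Cn n)) (M : ℕ) : Set (Endo n) :=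
  {f | ∃ j : ℕ, ∃ x ∈ U, (M : ℝ) < ‖(eapp f)^[j] x‖}

lemma isOpen_expSet (U : Set (Cn n)) (M : ℕ) : IsOpen (expSet U M) := by
  rw [isOpen_iff_mem_nhds]
  rintro f ⟨j, x, hx, hj⟩
  have := ((iter_cont j x).norm.tendsto f).eventually (lt_mem_nhds hj)
  filter_upwards [this] with g hg
  exact ⟨j, x, hx, hg⟩

lemma mem_cob {X : Type*} [TopologicalSpace X] {s : Set X} {x : X} (h : x ∈ coborder s)
    (hx : x ∈ closure s) : x ∈ s := by
  by_contra hc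
  exact h ⟨hx, hc⟩

lemma rne_of_bdd (f : Endo n) (p : Cn n)
    (hf : ∀ U ∈ TopologicalSpace.countableBasis (Cn n), ∀ M, f ∈ coborder (expSet U M))
    (V : Set (Cn n)) (hV : IsOpen V) (hp : p ∈ V)
    (K : Set (Cn n)) (hK : IsCompact K) (h : ∀ k : ℕ, 1 ≤ k → (eapp f)^[k] '' V ⊆ K) :
    p ∈ rne f := by
  obtain ⟨U, hU, hpU, hUV⟩ := (TopologicalSpace.isBasis_countableBasis (Cn n)).exists_subset_of_mem_open
    (show p ∈ V ∩ ball p 1 from ⟨hp, mem_ball_self one_pos⟩) (hV.inter isOpen_ball)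
  obtain ⟨M', hM'⟩ := (hK.union (isCompact_closedBall p 1)).isBounded.exists_norm_le
  obtain ⟨M, hM⟩ := exists_nat_ge M'
  have hbd : f ∉ expSet U M := by
    rintro ⟨k, x, hx, hk⟩
    have : ‖(eapp f)^[k] x‖ ≤ M' := by
      apply hM'
      rcases Nat.eq_zero_or_pos k with rfl | hk
      · exact Or.inr (ball_subset_closedBall (hUV hx).2)
      · exact Or.inl (h k hk ⟨x, (hUV hx).1, rfl⟩)
    linarith
  have hcl : f ∉ closure (expSet U M) := fun hc => hbd (mem_cob (hf U hU M) hc)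
  refine ⟨U, TopologicalSpace.isOpen_of_mem_countableBasis hU, hpU, (closure (expSet U M))ᶜ,
    isClosed_closure.isOpen_compl.mem_nhds hcl, closedBall 0 M, isCompact_closedBall _ _, ?_⟩
  rintro g hg j _ ⟨x, hx, rfl⟩
  rw [mem_closedBall_zero_iff]
  by_contra hc
  exact hg (subset_closure ⟨j, x, hx, not_le.1 hc⟩)

lemma bdd_of_fatou (f : Endo n) (p : Cn n)
    (hf : ∀ U ∈ TopologicalSpace.countableBasis (Cn n), f ∈ coborder (trapSet U))
    (h : FatouAt f p) : ∃ V : Set (Cn n), IsOpen V ∧ p ∈ V ∧ ∃ K : Set (Cn n), IsCompact K ∧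
        ∀ k : ℕ, 1 ≤ k → (eapp f)^[k] '' V ⊆ K := by
  obtain ⟨U, hU, hpU, hN⟩ := h
  obtain ⟨ρ, hρ, hb⟩ := Metric.nhds_basis_closedBall.mem_iff.1 (hU.mem_nhds hpU)
  by_contra hcon
  have hex : ∀ m : ℕ, ∃ k > m, ∃ x ∈ closedBall p ρ, (m : ℝ) < ‖(eapp f)^[k] x‖ := by
    intro m
    by_contra hc
    push Not at hc
    refine hcon ⟨ball p ρ, isOpen_ball, mem_ball_self hρ,
      closedBall 0 m ∪ ⋃ k ∈ Finset.range (m + 1), (eapp f)^[k] '' closedBall p ρ, ?_, ?_⟩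
    · exact (isCompact_closedBall _ _).union ((Finset.range (m + 1)).isCompact_biUnion fun k _ =>
        (isCompact_closedBall p ρ).image (iter_diff f k).continuous)
    · rintro k - _ ⟨x, hx, rfl⟩
      rcases lt_or_ge m k with hk | hk
      · exact Or.inl (mem_closedBall_zero_iff.2 (hc k hk x (ball_subset_closedBall hx)))
      · refine Or.inr (Set.mem_biUnion (x := k) ?_ ⟨x, ball_subset_closedBall hx, rfl⟩)
        simpa using Nat.lt_succ_of_le hk
  obtain ⟨k, hk, hkx⟩ := extraction_forall_of_frequently
    (P := fun m k => ∃ x ∈ closedBall p ρ, (m : ℝ) < ‖(eapp f)^[k] x‖) (by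
      intro m
      rw [frequently_atTop]
      intro b
      obtain ⟨k, hk, x, hx, hlt⟩ := hex (max m b)
      refine ⟨k, (le_max_right m b).trans hk.le, x, hx, lt_of_le_of_lt ?_ hlt⟩
      exact_mod_cast le_max_left m b)
  obtain ⟨l, hl, hconv | hdiv⟩ := hN k hk
  · obtain ⟨g, hg, ht⟩ := hconv
    have hu := (tendstoLocallyUniformlyOn_iff_forall_isCompact hU).1 ht _ hb
      (isCompact_closedBall p ρ)
    obtain ⟨C, hC⟩ := (isCompact_closedBall p ρ).exists_bound_of_continuousOn
      (hg.continuousOn.mono hb)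
    have h1 := Metric.tendstoUniformlyOn_iff.1 hu 1 one_pos
    obtain ⟨N, hN⟩ := exists_nat_ge (C + 1)
    obtain ⟨j, hj1, hj2⟩ := (h1.and (eventually_ge_atTop N)).exists
    obtain ⟨x, hx, hlt⟩ := hkx (l j)
    have h2 := hj1 x hx
    rw [dist_comm, dist_eq_norm] at h2
    have h3 := hC x hx
    have h4 : (N : ℝ) ≤ l j := by exact_mod_cast hj2.trans (hl.id_le j)
    have h5 := norm_sub_norm_le ((eapp f)^[k (l j)] x) (g x)
    linarith
  · obtain ⟨B, hB, hpB, hBU⟩ :=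
      (TopologicalSpace.isBasis_countableBasis (Cn n)).exists_subset_of_mem_open hpU hU
    have hcl : f ∈ closure (trapSet B) := by
      refine perturb hpB fun R => ?_
      obtain ⟨j, hj⟩ := (hdiv {p} (by simpa using hpU) isCompact_singleton (closedBall 0 R)
        (isCompact_closedBall _ _)).exists
      refine ⟨k (l j), ?_⟩
      by_contra hc
      exact Set.disjoint_left.1 hj ⟨p, rfl, rfl⟩ (mem_closedBall_zero_iff.2 (not_lt.1 hc))
    obtain ⟨x, hx, j, a, δ, hxk⟩ := trap_bdd (mem_cob (hf B hB) hcl)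
    obtain ⟨i, hi1, hi2⟩ := ((hdiv {x} (by simpa using hBU hx) isCompact_singleton
      (closedBall a δ) (isCompact_closedBall _ _)).and (eventually_ge_atTop j)).exists
    exact Set.disjoint_left.1 hi1 ⟨x, rfl, rfl⟩
      (hxk _ (hi2.trans ((hl.id_le i).trans (hk.id_le _))))

/-- For a generic endomorphism `f` of `ℂⁿ`, `F_f = rne(f)`; moreover `F_f` is the set of
points with a neighbourhood whose forward images all stay in a fixed compact set. -/
theorem stmt_9 (n : ℕ) (hn : 1 ≤ n) :
    {f : Endo n | Fatou f = rne f ∧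
      Fatou f = {p | ∃ V : Set (Cn n), IsOpen V ∧ p ∈ V ∧ ∃ K : Set (Cn n), IsCompact K ∧
        ∀ k : ℕ, 1 ≤ k → (eapp f)^[k] '' V ⊆ K}} ∈ residual (Endo n) := by
  have h1 : ∀ᶠ f : Endo n in residual (Endo n),
      ∀ U ∈ TopologicalSpace.countableBasis (Cn n), f ∈ coborder (trapSet U) :=
    (eventually_countable_ball (TopologicalSpace.countable_countableBasis _)).2 fun U _ =>
      coborder_mem_residual (isOpen_trapSet U).isLocallyClosed
  have h2 : ∀ᶠ f : Endo n in residual (Endo n),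
      ∀ U ∈ TopologicalSpace.countableBasis (Cn n), ∀ M, f ∈ coborder (expSet U M) :=
    (eventually_countable_ball (TopologicalSpace.countable_countableBasis _)).2 fun U _ =>
      eventually_countable_forall.2 fun M =>
        coborder_mem_residual (isOpen_expSet U M).isLocallyClosed
  filter_upwards [h1, h2] with f hf1 hf2
  have e1 : Fatou f = {p | ∃ V : Set (Cn n), IsOpen V ∧ p ∈ V ∧ ∃ K : Set (Cn n), IsCompact K ∧
        ∀ k : ℕ, 1 ≤ k → (eapp f)^[k] '' V ⊆ K} := by
    ext p
    constructor
    · exact bdd_of_fatou f p hf1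
    · rintro ⟨V, hV, hp, K, hK, h⟩
      exact fatou_of_bdd f p V hV hp K hK h
  refine ⟨?_, e1⟩
  rw [e1]
  ext p
  constructor
  · rintro ⟨V, hV, hp, K, hK, h⟩
    exact rne_of_bdd f p hf2 V hV hp K hK h
  · rintro ⟨U, hU, hp, V, hV, K, hK, h⟩
    exact ⟨U, hU, hp, K, hK, fun k _ => h f (mem_of_mem_nhds hV) k⟩
end
end
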